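/- Let 1 < p < ∞, 1/p + 1/p′ = 1, and let Q₀ ⊂ ℝⁿ be a cube with sides parallel to the coordinate axes. Then for every f ∈ L¹(Q₀), sup_{t>0} t^{1/p} ( f**(t) − f*(t) ) ≤ 2^{n/p′ + 1} · GaRo_p(f,Q₀) + (4/|Q₀|)^{1/p′} · ‖f‖_{L¹(Q₀)}, where f* is the non-increasing rearrangement of f on Q₀ and f**(t) = (1/t)∫₀ᵗ f*(s) ds. -/

import Mathlib

open MeasureTheory Set
open scoped ENNReal NNReal

noncomputable section

/-- The distribution function `λ_f(t) = μ {x : |f(x)| > t}`. -/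
def distFun {α : Type*} [MeasurableSpace α] (μ : Measure α) (f : α → ℝ) (t : ℝ) : ℝ≥0∞ :=
  μ {x | t < |f x|}

/-- The non-increasing rearrangement `f*(t) = inf {s > 0 : λ_f(s) ≤ t}`. -/
def rearr {α : Type*} [MeasurableSpace α] (μ : Measure α) (f : α → ℝ) (t : ℝ) : ℝ≥0∞ :=
  sInf (ENNReal.ofReal '' {s : ℝ | 0 < s ∧ distFun μ f s ≤ ENNReal.ofReal t})

/-- The maximal function `f**(t) = (1/t) ∫₀ᵗ f*(s) ds`. -/
def dstar {α : Type*} [MeasurableSpace α] (μ : Measure α) (f : α → ℝ) (t : ℝ) : ℝ≥0∞ :=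
  (∫⁻ s in Set.Ioc (0 : ℝ) t, rearr μ f s) / ENNReal.ofReal t

/-- The `L(∞,∞)` "norm" : `sup_{t>0} (f**(t) - f*(t))`. -/
def oscNorm {α : Type*} [MeasurableSpace α] (μ : Measure α) (f : α → ℝ) : ℝ≥0∞ :=
  ⨆ (t : ℝ) (_ : 0 < t), dstar μ f t - rearr μ f t

/-- The Marcinkiewicz `L(p,∞)` quasinorm `‖f‖*_{L(p,∞)} = sup_{t>0} t (λ_f(t))^{1/p}`. -/
def wkNorm {α : Type*} [MeasurableSpace α] (μ : Measure α) (p : ℝ) (f : α → ℝ) : ℝ≥0∞ :=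
  ⨆ (t : ℝ) (_ : 0 < t), ENNReal.ofReal t * distFun μ f t ^ (1 / p)

/-- `‖f‖_{L(p,∞)} = sup_{s>0} s^{1/p} f**(s)`. -/
def wkNormStarStar {α : Type*} [MeasurableSpace α] (μ : Measure α) (p : ℝ) (f : α → ℝ) : ℝ≥0∞ :=
  ⨆ (s : ℝ) (_ : 0 < s), ENNReal.ofReal s ^ (1 / p) * dstar μ f s

/-- `‖f‖*_{L(p,∞)} = sup_{s>0} s^{1/p} f*(s)` (rearrangement form). -/
def wkNormStar {α : Type*} [MeasurableSpace α] (μ : Measure α) (p : ℝ) (f : α → ℝ) : ℝ≥0∞ :=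
  ⨆ (s : ℝ) (_ : 0 < s), ENNReal.ofReal s ^ (1 / p) * rearr μ f s

/-- `‖f‖^#_{L(p,∞)} = sup_{s>0} s^{1/p} (f**(s) - f*(s))`. -/
def sharpNorm {α : Type*} [MeasurableSpace α] (μ : Measure α) (p : ℝ) (f : α → ℝ) : ℝ≥0∞ :=
  ⨆ (s : ℝ) (_ : 0 < s), ENNReal.ofReal s ^ (1 / p) * (dstar μ f s - rearr μ f s)

/-- `‖f‖^{##}_{L(p,∞)} = sup_{t>0} (λ_f(t))^{-(1-1/p)} ∫_t^∞ λ_f(s) ds`. -/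
def sharpSharpNorm {α : Type*} [MeasurableSpace α] (μ : Measure α) (p : ℝ) (f : α → ℝ) : ℝ≥0∞ :=
  ⨆ (t : ℝ) (_ : 0 < t),
    distFun μ f t ^ (-(1 - 1 / p)) * ∫⁻ s in Set.Ioi t, distFun μ f s

/-- `‖f‖^{##}_{L(∞,∞)} = inf {C : ∫_t^∞ λ_f(s) ds ≤ C λ_f(t) for all t > 0}`. -/
def sharpSharpInf {α : Type*} [MeasurableSpace α] (μ : Measure α) (f : α → ℝ) : ℝ≥0∞ :=
  sInf {C : ℝ≥0∞ | ∀ t : ℝ, 0 < t →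
    ∫⁻ s in Set.Ioi t, distFun μ f s ≤ C * distFun μ f t}

/-- O'Neil's quantity `inf {C^{1/p} : ∫_t^∞ λ_f(s) ds ≤ C t^{1-p} for all t > 0}`. -/
def oneilQuantity {α : Type*} [MeasurableSpace α] (μ : Measure α) (p : ℝ) (f : α → ℝ) : ℝ≥0∞ :=
  sInf {D : ℝ≥0∞ | ∃ C : ℝ≥0∞, D = C ^ (1 / p) ∧
    ∀ t : ℝ, 0 < t → ∫⁻ s in Set.Ioi t, distFun μ f s ≤ C * ENNReal.ofReal t ^ (1 - p)}

/-- A cube in `ℝⁿ` with sides parallel to the coordinate axes. -/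
def IsCube {n : ℕ} (Q : Set (Fin n → ℝ)) : Prop :=
  ∃ (a : Fin n → ℝ) (l : ℝ), 0 < l ∧ Q = Set.univ.pi fun i => Set.Icc (a i) (a i + l)

/-- A countable family of subcubes of `Q₀` with pairwise disjoint interiors. -/
def IsPackingIn {n : ℕ} (Q₀ : Set (Fin n → ℝ)) (Q : ℕ → Set (Fin n → ℝ)) : Prop :=
  (∀ i, IsCube (Q i) ∧ Q i ⊆ Q₀) ∧
    Pairwise fun i j => interior (Q i) ∩ interior (Q j) = ∅

/-- The average `f_Q = (1/|Q|) ∫_Q f`. -/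
def cubeAvg {n : ℕ} (f : (Fin n → ℝ) → ℝ) (Q : Set (Fin n → ℝ)) : ℝ :=
  ⨍ x in Q, f x

/-- The mean oscillation `(1/|Q|) ∫_Q |f - f_Q|`. -/
def meanOsc {n : ℕ} (f : (Fin n → ℝ) → ℝ) (Q : Set (Fin n → ℝ)) : ℝ :=
  ⨍ x in Q, |f x - cubeAvg f Q|

/-- The John–Nirenberg functional `JN_p(f,Q₀)`. -/
def JN {n : ℕ} (p : ℝ) (f : (Fin n → ℝ) → ℝ) (Q₀ : Set (Fin n → ℝ)) : ℝ≥0∞ :=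
  ⨆ (Q : ℕ → Set (Fin n → ℝ)) (_ : IsPackingIn Q₀ Q),
    (∑' i, volume (Q i) * ENNReal.ofReal (meanOsc f (Q i)) ^ p) ^ (1 / p)

/-- The BMO norm `‖f‖_{BMO(Q₀)}`. -/
def bmoNorm {n : ℕ} (f : (Fin n → ℝ) → ℝ) (Q₀ : Set (Fin n → ℝ)) : ℝ≥0∞ :=
  ⨆ (Q : Set (Fin n → ℝ)) (_ : IsCube Q ∧ Q ⊆ Q₀), ENNReal.ofReal (meanOsc f Q)

/-- The Garsia–Rodemich functional `GaRo_p(f,Q₀)`: the least constant `C` such that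
for every packing `{Qᵢ}` of `Q₀`,
`Σᵢ (1/|Qᵢ|) ∫_{Qᵢ}∫_{Qᵢ} |f(x)-f(y)| dx dy ≤ C (Σᵢ |Qᵢ|)^{1/p'}` where `1/p' = 1 - 1/p`. -/
def GaRo {n : ℕ} (p : ℝ) (f : (Fin n → ℝ) → ℝ) (Q₀ : Set (Fin n → ℝ)) : ℝ≥0∞ :=
  sInf {C : ℝ≥0∞ | ∀ Q : ℕ → Set (Fin n → ℝ), IsPackingIn Q₀ Q →
    (∑' i, (volume (Q i))⁻¹ *
        ∫⁻ x in Q i, ∫⁻ y in Q i, ENNReal.ofReal |f x - f y|) ≤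
      C * (∑' i, volume (Q i)) ^ (1 - 1 / p)}

section Rearrangement

variable {α : Type*} [MeasurableSpace α] {μ : Measure α} {f g : α → ℝ}

lemma rearr_le_ofReal {r σ : ℝ} (hσ : 0 < σ) (h : distFun μ f σ ≤ ENNReal.ofReal r) :
    rearr μ f r ≤ ENNReal.ofReal σ :=
  sInf_le ⟨σ, ⟨hσ, h⟩, rfl⟩

lemma rearr_antitone : Antitone (rearr μ f) := fun _ _ hab =>
  sInf_le_sInf <| image_mono fun _ hs => ⟨hs.1, hs.2.trans (ENNReal.ofReal_le_ofReal hab)⟩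

lemma distFun_antitone : Antitone (distFun μ f) := fun _ _ hst =>
  measure_mono fun _ hx => lt_of_le_of_lt hst hx

lemma rearr_ne_top (hf : Integrable f μ) {r : ℝ} (hr : 0 < r) : rearr μ f r ≠ ∞ := by
  have hI : ∫⁻ x, ENNReal.ofReal |f x| ∂μ ≠ ∞ := by
    have h := (hasFiniteIntegral_iff_norm f).1 hf.2
    exact h.ne
  set M := (∫⁻ x, ENNReal.ofReal |f x| ∂μ).toReal
  have hM : 0 ≤ M := ENNReal.toReal_nonneg
  have hσ : 0 < (M + 1) / r := by positivity
  refine ne_top_of_le_ne_top ENNReal.ofReal_ne_top (rearr_le_ofReal hσ ?_)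
  have hm : AEMeasurable (fun x => ENNReal.ofReal |f x|) μ :=
    (continuous_abs.measurable.comp_aemeasurable hf.1.aemeasurable).ennreal_ofReal
  have h1 : distFun μ f ((M + 1) / r) ≤ μ {x | ENNReal.ofReal ((M + 1) / r) ≤ ENNReal.ofReal |f x|} :=
    measure_mono fun x hx => ENNReal.ofReal_le_ofReal (le_of_lt hx)
  refine h1.trans ((meas_ge_le_lintegral_div hm (by simpa using hσ) ENNReal.ofReal_ne_top).trans ?_)
  rw [← ENNReal.ofReal_toReal hI, ← ENNReal.ofReal_div_of_pos hσ]
  refine ENNReal.ofReal_le_ofReal ?_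
  rw [div_le_iff₀ hσ]
  change M ≤ _
  field_simp
  linarith

/-- `λ_f(f*(t)) ≤ t`. -/
lemma distFun_toReal_rearr_le (hf : Integrable f μ) {t : ℝ} (ht : 0 < t) :
    distFun μ f (rearr μ f t).toReal ≤ ENNReal.ofReal t := by
  set s := (rearr μ f t).toReal
  have hU : {x | s < |f x|} ⊆ ⋃ k : ℕ, {x | s + 1 / ((k : ℝ) + 1) < |f x|} := by
    intro x hx
    have hx' : 0 < |f x| - s := sub_pos.2 hx
    obtain ⟨k, hk⟩ := exists_nat_one_div_lt hx'
    exact mem_iUnion.2 ⟨k, by change s + 1 / ((k : ℝ) + 1) < |f x|; linarith⟩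
  refine (measure_mono hU).trans ?_
  rw [Directed.measure_iUnion]
  · refine iSup_le fun k => ?_
    have hlt : rearr μ f t < ENNReal.ofReal (s + 1 / ((k : ℝ) + 1)) := by
      rw [← ENNReal.ofReal_toReal (rearr_ne_top hf ht)]
      have : (0 : ℝ) < 1 / ((k : ℝ) + 1) := by positivity
      exact (ENNReal.ofReal_lt_ofReal_iff (by positivity)).2 (by linarith)
    obtain ⟨_, ⟨σ, ⟨hσ, hd⟩, rfl⟩, hσlt⟩ := sInf_lt_iff.1 hlt
    exact (distFun_antitone ((ENNReal.ofReal_lt_ofReal_iff_of_nonneg hσ.le).1 hσlt).le).trans hd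
  · refine directed_of_isDirected_le fun j k hjk x hx => ?_
    have : 1 / ((k : ℝ) + 1) ≤ 1 / ((j : ℝ) + 1) := Nat.one_div_le_one_div hjk
    change s + 1 / ((j : ℝ) + 1) < |f x| at hx
    change s + 1 / ((k : ℝ) + 1) < |f x|
    linarith

lemma lintegral_rearr_sub_le (hf : Integrable f μ) {s : ℝ} (hs : 0 ≤ s) (t : ℝ) :
    ∫⁻ r in Ioc 0 t, ENNReal.ofReal ((rearr μ f r).toReal - s) ≤
      ∫⁻ x, ENNReal.ofReal (|f x| - s) ∂μ := by
  have hanti : AntitoneOn (fun r => max ((rearr μ f r).toReal - s) 0) (Ioc 0 t) := by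
    intro a ha b _ hab
    refine max_le_max (sub_le_sub_right ?_ s) le_rfl
    exact ENNReal.toReal_mono (rearr_ne_top hf ha.1) (rearr_antitone hab)
  have hmax (y : ℝ) : ENNReal.ofReal y = ENNReal.ofReal (max y 0) := by simp
  rw [lintegral_congr fun r => hmax ((rearr μ f r).toReal - s),
    lintegral_congr fun x => hmax (|f x| - s),
    lintegral_eq_lintegral_meas_lt (f := fun r => max ((rearr μ f r).toReal - s) 0) _
      (ae_of_all _ fun _ => le_max_right _ _)
      (aemeasurable_restrict_of_antitoneOn measurableSet_Ioc hanti),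
    lintegral_eq_lintegral_meas_lt (f := fun x => max (|f x| - s) 0) _
      (ae_of_all _ fun _ => le_max_right _ _)
      (((continuous_abs.measurable.comp_aemeasurable hf.1.aemeasurable).sub_const s).max
        aemeasurable_const)]
  refine setLIntegral_mono' measurableSet_Ioi fun σ hσ => ?_
  have hσ' : (0 : ℝ) < σ := hσ
  have hd : distFun μ f (s + σ) ≤ μ {a | σ < max (|f a| - s) 0} :=
    measure_mono fun x (hx : s + σ < |f x|) => lt_max_of_lt_left (lt_sub_iff_add_lt'.2 hx)
  refine le_trans ?_ hd
  rw [Measure.restrict_apply' measurableSet_Ioc]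
  by_cases htop : distFun μ f (s + σ) = ∞
  · simp [htop]
  have hsub : {a | σ < max ((rearr μ f a).toReal - s) 0} ∩ Ioc 0 t ⊆
      Ioc 0 (distFun μ f (s + σ)).toReal := by
    rintro r ⟨hr, hr0, -⟩
    refine ⟨hr0, ?_⟩
    by_contra! hlt
    have h1 : distFun μ f (s + σ) ≤ ENNReal.ofReal r := by
      rw [← ENNReal.ofReal_toReal htop]
      exact ENNReal.ofReal_le_ofReal hlt.le
    have h2 := ENNReal.toReal_mono ENNReal.ofReal_ne_top
      (rearr_le_ofReal (by positivity : 0 < s + σ) h1)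
    rw [ENNReal.toReal_ofReal (by positivity)] at h2
    rcases lt_max_iff.1 (show σ < max ((rearr μ f r).toReal - s) 0 from hr) with h | h <;> linarith
  refine (measure_mono hsub).trans ?_
  rw [Real.volume_Ioc, sub_zero, ENNReal.ofReal_toReal htop]

lemma lintegral_rearr_le (hf : Integrable f μ) (t : ℝ) :
    ∫⁻ r in Ioc 0 t, rearr μ f r ≤ ∫⁻ x, ENNReal.ofReal |f x| ∂μ := by
  have h := lintegral_rearr_sub_le hf le_rfl t
  simp only [sub_zero] at h
  refine le_trans (setLIntegral_mono' measurableSet_Ioc fun r hr => ?_) h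
  rw [ENNReal.ofReal_toReal (rearr_ne_top hf hr.1)]

lemma dstar_sub_rearr_le (hf : Integrable f μ) {t : ℝ} (ht : 0 < t) :
    dstar μ f t - rearr μ f t ≤
      (∫⁻ x, ENNReal.ofReal (|f x| - (rearr μ f t).toReal) ∂μ) / ENNReal.ofReal t := by
  have ht0 : ENNReal.ofReal t ≠ 0 := by simpa using ht
  set s := (rearr μ f t).toReal with hs_def
  have hs : ENNReal.ofReal s = rearr μ f t := ENNReal.ofReal_toReal (rearr_ne_top hf ht)
  rw [tsub_le_iff_right, dstar, ENNReal.div_le_iff ht0 ENNReal.ofReal_ne_top, add_mul,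
    ENNReal.div_mul_cancel ht0 ENNReal.ofReal_ne_top]
  refine le_trans ?_ (add_le_add_left
    (lintegral_rearr_sub_le hf (ENNReal.toReal_nonneg : 0 ≤ s) t) _)
  have hc : rearr μ f t * ENNReal.ofReal t = ∫⁻ _ in Ioc 0 t, ENNReal.ofReal s := by
    simp [hs]
  rw [hc, ← lintegral_add_right _ measurable_const]
  refine setLIntegral_mono' measurableSet_Ioc fun r hr => ?_
  rw [← ENNReal.ofReal_toReal (rearr_ne_top hf hr.1)]
  refine le_trans (ENNReal.ofReal_le_ofReal ?_) ENNReal.ofReal_add_le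
  rw [ENNReal.toReal_ofReal ENNReal.toReal_nonneg]
  linarith

lemma distFun_congr_ae (h : f =ᵐ[μ] g) : distFun μ f = distFun μ g := by
  funext t
  refine measure_congr ?_
  filter_upwards [h] with x hx
  change (t < |f x|) = (t < |g x|)
  rw [hx]

lemma rearr_congr_ae (h : f =ᵐ[μ] g) : rearr μ f = rearr μ g := by
  funext t
  rw [rearr, rearr, distFun_congr_ae h]

lemma dstar_congr_ae (h : f =ᵐ[μ] g) : dstar μ f = dstar μ g := by
  funext t
  rw [dstar, dstar, rearr_congr_ae h]

end Rearrangement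

section Selection

/-- The stopping-time selection of maximal cells in a nested sequence of partitions: `idx m x` is
the label of the cell of generation `m` containing `x`. -/
lemma exists_maximal_parent_cells {α κ : Type*} (idx : ℕ → α → κ)
    (hnest : ∀ m x y, idx (m + 1) x = idx (m + 1) y → idx m x = idx m y)
    (D : ℕ → κ → Prop) (h0 : ∀ x, ¬ D 0 (idx 0 x)) :
    ∃ I : Set (ℕ × κ),
      (∀ q ∈ I, ¬ D q.1 q.2 ∧ ∃ y, idx q.1 y = q.2 ∧ D (q.1 + 1) (idx (q.1 + 1) y)) ∧
      (∀ q ∈ I, ∀ q' ∈ I, ∀ z, idx q.1 z = q.2 → idx q'.1 z = q'.2 → q = q') ∧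
      ∀ x m, D m (idx m x) → ∃ q ∈ I, idx q.1 x = q.2 := by
  classical
  have hle : ∀ m j x y, j ≤ m → idx m x = idx m y → idx j x = idx j y := by
    intro m j x y hjm h
    induction m, hjm using Nat.le_induction with
    | base => exact h
    | succ m _ ih => exact ih (hnest m x y h)
  set B : ℕ → κ → Prop := fun m k => ∃ y, idx m y = k ∧ D (m + 1) (idx (m + 1) y)
  refine ⟨{q | B q.1 q.2 ∧ ∃ x, idx q.1 x = q.2 ∧ ∀ j < q.1, ¬ B j (idx j x)}, ?_, ?_, ?_⟩
  · rintro ⟨m, k⟩ ⟨hB, x, hx, hmin⟩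
    refine ⟨fun hD => ?_, hB⟩
    simp only at hx hmin hD
    subst hx
    cases m with
    | zero => exact h0 x hD
    | succ m => exact hmin m (Nat.lt_succ_self m) ⟨x, rfl, hD⟩
  · have key : ∀ q q' : ℕ × κ, ∀ z, B q.1 q.2 → idx q.1 z = q.2 → idx q'.1 z = q'.2 →
        (∃ x, idx q'.1 x = q'.2 ∧ ∀ j < q'.1, ¬ B j (idx j x)) → q'.1 ≤ q.1 := by
      rintro q q' z hB hz hz' ⟨x, hx, hmin⟩
      by_contra! hlt
      refine hmin _ hlt ?_
      rw [hle _ _ x z hlt.le (hx.trans hz'.symm), hz]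
      exact hB
    rintro q ⟨hB, hx⟩ q' ⟨hB', hx'⟩ z hz hz'
    have h : q.1 = q'.1 := le_antisymm (key q' q z hB' hz' hz hx) (key q q' z hB hz hz' hx')
    refine Prod.ext h ?_
    rw [← hz, ← hz', h]
  · intro x m hD
    have hex : ∃ m, B m (idx m x) := by
      cases m with
      | zero => exact absurd hD (h0 x)
      | succ m => exact ⟨m, x, rfl, hD⟩
    exact ⟨(Nat.find hex, idx (Nat.find hex) x),
      ⟨Nat.find_spec hex, x, rfl, fun j hj => Nat.find_min hex hj⟩, rfl⟩

end Selection

section Cubes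

variable {n : ℕ} {P Q₀ : Set (Fin n → ℝ)}

lemma IsCube.convex (hP : IsCube P) : Convex ℝ P := by
  obtain ⟨a, l, -, rfl⟩ := hP
  exact convex_pi fun i _ => convex_Icc _ _

lemma IsCube.measurableSet (hP : IsCube P) : MeasurableSet P := by
  obtain ⟨a, l, -, rfl⟩ := hP
  exact MeasurableSet.univ_pi fun i => measurableSet_Icc

lemma IsCube.interior_ae_eq (hP : IsCube P) : interior P =ᵐ[volume] P :=
  interior_ae_eq_of_null_frontier (hP.convex.addHaar_frontier volume)

lemma volume_box (a : Fin n → ℝ) (l : ℝ) :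
    volume (univ.pi fun i => Icc (a i) (a i + l)) = ENNReal.ofReal l ^ n := by
  rw [volume_pi_pi]
  simp

lemma IsCube.volume_ne_zero (hP : IsCube P) : volume P ≠ 0 := by
  obtain ⟨a, l, hl, rfl⟩ := hP
  rw [volume_box]
  exact pow_ne_zero _ (by simpa using hl)

lemma IsCube.volume_ne_top (hP : IsCube P) : volume P ≠ ∞ := by
  obtain ⟨a, l, hl, rfl⟩ := hP
  rw [volume_box]
  exact ENNReal.pow_ne_top ENNReal.ofReal_ne_top

lemma tsum_volume_inter_le {ι : Type*} [Countable ι] {P : ι → Set (Fin n → ℝ)}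
    (hP : ∀ i, IsCube (P i)) (hd : Pairwise fun i j => interior (P i) ∩ interior (P j) = ∅)
    (E : Set (Fin n → ℝ)) : ∑' i, volume (E ∩ P i) ≤ volume E := by
  have h := tsum_meas_le_meas_iUnion_of_disjoint (volume.restrict E)
    (As := fun i => interior (P i)) (fun i => isOpen_interior.measurableSet)
    fun i j hij => disjoint_iff_inter_eq_empty.2 (hd hij)
  have h2 : ∀ i, volume (E ∩ P i) = volume.restrict E (interior (P i)) := fun i => by
    rw [Measure.restrict_apply isOpen_interior.measurableSet, inter_comm]
    exact measure_congr ((hP i).interior_ae_eq.symm.inter ae_eq_rfl)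
  simp_rw [h2]
  refine h.trans ((measure_mono (subset_univ _)).trans ?_)
  simp

lemma tsum_volume_le {ι : Type*} [Countable ι] {P : ι → Set (Fin n → ℝ)}
    (hP : ∀ i, IsCube (P i)) (hd : Pairwise fun i j => interior (P i) ∩ interior (P j) = ∅)
    (hsub : ∀ i, P i ⊆ Q₀) : ∑' i, volume (P i) ≤ volume Q₀ := by
  refine le_trans (le_of_eq ?_) (tsum_volume_inter_le hP hd Q₀)
  exact tsum_congr fun i => by rw [inter_eq_self_of_subset_right (hsub i)]

/-- Cubes strung along the diagonal of a cube. -/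
def diagCube (a : Fin n → ℝ) (l r : ℝ) (k : ℕ) : Set (Fin n → ℝ) :=
  univ.pi fun i => Icc (a i + l * (1 - r ^ k)) (a i + l * (1 - r ^ (k + 1)))

lemma isCube_diagCube (a : Fin n → ℝ) {l r : ℝ} (hl : 0 < l) (hr : 0 < r) (hr1 : r < 1) (k : ℕ) :
    IsCube (diagCube a l r k) := by
  refine ⟨fun i => a i + l * (1 - r ^ k), l * (r ^ k * (1 - r)), ?_, ?_⟩
  · have : 0 < 1 - r := by linarith
    positivity
  · unfold diagCube
    congr! 3
    ring

lemma diagCube_subset (a : Fin n → ℝ) {l r : ℝ} (hl : 0 < l) (hr : 0 < r) (hr1 : r < 1) (k : ℕ) :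
    diagCube a l r k ⊆ univ.pi fun i => Icc (a i) (a i + l) := by
  refine pi_mono fun i _ => Icc_subset_Icc ?_ ?_
  · have : r ^ k ≤ 1 := pow_le_one₀ hr.le hr1.le
    nlinarith
  · have : 0 < r ^ (k + 1) := by positivity
    nlinarith

lemma interior_diagCube_inter (hn : 0 < n) (a : Fin n → ℝ) {l r : ℝ} (hl : 0 < l) (hr : 0 < r)
    (hr1 : r < 1) : Pairwise fun j k =>
      interior (diagCube a l r j) ∩ interior (diagCube a l r k) = ∅ := by
  have key : ∀ j k, j < k → interior (diagCube a l r j) ∩ interior (diagCube a l r k) = ∅ := by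
    intro j k hjk
    refine eq_empty_of_forall_notMem fun x hx => ?_
    simp only [diagCube, interior_pi_set finite_univ, interior_Icc] at hx
    have h1 := (hx.1 ⟨0, hn⟩ trivial).2
    have h2 := (hx.2 ⟨0, hn⟩ trivial).1
    have : r ^ k ≤ r ^ (j + 1) := pow_le_pow_of_le_one hr.le hr1.le hjk
    nlinarith
  intro j k hjk
  rcases lt_or_gt_of_ne hjk with h | h
  · exact key j k h
  · rw [inter_comm]
    exact key k j h

lemma monotone_diagCube_zero (a : Fin n → ℝ) {l : ℝ} (hl : 0 < l) :
    Monotone fun k : ℕ => diagCube a l (1 / ((k : ℝ) + 2)) 0 := by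
  intro j k hjk
  refine pi_mono fun i _ => Icc_subset_Icc (by simp) ?_
  have : 1 / ((k : ℝ) + 2) ≤ 1 / ((j : ℝ) + 2) := by gcongr
  simp only [zero_add, pow_one]
  gcongr

lemma lintegral_eq_iSup_diagCube {g : (Fin n → ℝ) → ℝ} (hg : Measurable g) (a : Fin n → ℝ) {l : ℝ}
    (hl : 0 < l) :
    ∫⁻ x in univ.pi fun i => Icc (a i) (a i + l), ∫⁻ y in univ.pi fun i => Icc (a i) (a i + l),
        ENNReal.ofReal |g x - g y| =
      ⨆ k : ℕ, ∫⁻ x in diagCube a l (1 / ((k : ℝ) + 2)) 0,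
        ∫⁻ y in diagCube a l (1 / ((k : ℝ) + 2)) 0, ENNReal.ofReal |g x - g y| := by
  set P := univ.pi fun i => Icc (a i) (a i + l) with hP_def
  have hP : IsCube P := ⟨a, l, hl, rfl⟩
  set F : (Fin n → ℝ) × (Fin n → ℝ) → ℝ≥0∞ := fun z => ENNReal.ofReal |g z.1 - g z.2|
  have hF : Measurable F :=
    (continuous_abs.measurable.comp
      ((hg.comp measurable_fst).sub (hg.comp measurable_snd))).ennreal_ofReal
  have hconv : ∀ S : Set (Fin n → ℝ),
      ∫⁻ x in S, ∫⁻ y in S, ENNReal.ofReal |g x - g y| =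
        ∫⁻ z in S ×ˢ S, F z ∂(volume.prod volume) := fun S => by
    rw [← Measure.prod_restrict, lintegral_prod _ hF.aemeasurable]
  have hmono := monotone_diagCube_zero a hl
  simp_rw [hconv]
  rw [← setLIntegral_iUnion_of_directed]
  · refine le_antisymm ?_ ?_
    · have : ∫⁻ z in P ×ˢ P, F z ∂(volume.prod volume) =
          ∫⁻ z in interior P ×ˢ interior P, F z ∂(volume.prod volume) := by
        rw [← Measure.prod_restrict, ← Measure.prod_restrict,
          Measure.restrict_congr_set hP.interior_ae_eq]
      rw [this]
      refine lintegral_mono_set ?_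
      have hint : ∀ x ∈ interior P, ∀ᶠ k : ℕ in Filter.atTop,
          x ∈ diagCube a l (1 / ((k : ℝ) + 2)) 0 := by
        intro x hx
        rw [hP_def, interior_pi_set finite_univ] at hx
        simp only [interior_Icc] at hx
        simp only [diagCube, mem_univ_pi]
        refine Filter.eventually_all.2 fun i => ?_
        have hx1 := hx i trivial
        have ht : Filter.Tendsto (fun k : ℕ => 1 / ((k : ℝ) + 2)) Filter.atTop (nhds 0) := by
          have h := (Filter.tendsto_add_atTop_iff_nat 1).2
            (tendsto_one_div_add_atTop_nhds_zero_nat (𝕜 := ℝ))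
          refine h.congr fun k => ?_
          push_cast
          congr 1
          ring
        have hpos : 0 < (a i + l - x i) / l := div_pos (by linarith [hx1.2]) hl
        filter_upwards [ht.eventually (gt_mem_nhds hpos)] with k hk
        rw [lt_div_iff₀ hl] at hk
        refine ⟨by simpa using hx1.1.le, ?_⟩
        simp only [zero_add, pow_one]
        nlinarith
      rintro ⟨x, y⟩ ⟨hx, hy⟩
      obtain ⟨k, hk1, hk2⟩ := ((hint x hx).and (hint y hy)).exists
      exact mem_iUnion.2 ⟨k, hk1, hk2⟩
    · refine lintegral_mono_set (iUnion_subset fun k => ?_)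
      have : diagCube a l (1 / ((k : ℝ) + 2)) 0 ⊆ P :=
        diagCube_subset a hl (by positivity)
          ((div_lt_one (by positivity)).2 (by linarith [k.cast_nonneg (α := ℝ)])) 0
      exact prod_mono this this
  · exact directed_of_isDirected_le fun j k hjk => prod_mono (hmono hjk) (hmono hjk)

/-- The Garsia–Rodemich inequality, formulated for infinite packings, extends to packings indexed
by an arbitrary countable type. -/
lemma tsum_le_of_forall_packing {q : ℝ} (hq : 0 ≤ q) (hn : 0 < n) {g : (Fin n → ℝ) → ℝ}
    (hg : Measurable g) {C : ℝ≥0∞}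
    (hC : ∀ Q : ℕ → Set (Fin n → ℝ), IsPackingIn Q₀ Q →
      (∑' i, (volume (Q i))⁻¹ * ∫⁻ x in Q i, ∫⁻ y in Q i, ENNReal.ofReal |g x - g y|) ≤
        C * (∑' i, volume (Q i)) ^ q)
    {ι : Type*} [Countable ι] {P : ι → Set (Fin n → ℝ)}
    (hP : ∀ i, IsCube (P i)) (hd : Pairwise fun i j => interior (P i) ∩ interior (P j) = ∅)
    (hsub : ∀ i, P i ⊆ Q₀) :
    ∑' i, (volume (P i))⁻¹ * ∫⁻ x in P i, ∫⁻ y in P i, ENNReal.ofReal |g x - g y| ≤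
      C * (∑' i, volume (P i)) ^ q := by
  rcases isEmpty_or_nonempty ι with hι | hι
  · simp
  choose a l hl hPa using hP
  have hP : ∀ i, IsCube (P i) := fun i => ⟨a i, l i, hl i, hPa i⟩
  set D : ℝ → ι → ℕ → Set (Fin n → ℝ) := fun r i k => diagCube (a i) (l i) r k
  set J : Set (Fin n → ℝ) → ℝ≥0∞ := fun S => ∫⁻ x in S, ∫⁻ y in S, ENNReal.ofReal |g x - g y|
  have hstep : ∀ r : ℝ, 0 < r → r < 1 →
      ∑' i, (volume (P i))⁻¹ * J (D r i 0) ≤ C * (∑' i, volume (P i)) ^ q := by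
    intro r hr hr1
    have hDP : ∀ i k, D r i k ⊆ P i := fun i k => by
      rw [hPa i]
      exact diagCube_subset (a i) (hl i) hr hr1 k
    have hDc : ∀ i k, IsCube (D r i k) := fun i k => isCube_diagCube (a i) (hl i) hr hr1 k
    obtain ⟨e⟩ : Nonempty (ℕ ≃ ι × ℕ) := nonempty_equiv_of_countable
    have hpack : IsPackingIn Q₀ fun m => D r (e m).1 (e m).2 := by
      refine ⟨fun m => ⟨hDc _ _, (hDP _ _).trans (hsub _)⟩, fun m m' hm => ?_⟩
      by_cases h1 : (e m).1 = (e m').1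
      · have h2 : (e m).2 ≠ (e m').2 := fun h2 => hm (e.injective (Prod.ext h1 h2))
        simp only [h1]
        exact interior_diagCube_inter hn _ (hl _) hr hr1 h2
      · refine subset_empty_iff.1 (le_of_le_of_eq ?_ (hd h1))
        exact inter_subset_inter (interior_mono (hDP _ _)) (interior_mono (hDP _ _))
    have h := hC _ hpack
    rw [e.tsum_eq (fun z : ι × ℕ => (volume (D r z.1 z.2))⁻¹ * J (D r z.1 z.2)),
      e.tsum_eq (fun z : ι × ℕ => volume (D r z.1 z.2)),
      ENNReal.tsum_prod (f := fun i k => (volume (D r i k))⁻¹ * J (D r i k)),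
      ENNReal.tsum_prod (f := fun i k => volume (D r i k))] at h
    refine le_trans (ENNReal.tsum_le_tsum fun i => ?_) (h.trans ?_)
    · refine le_trans ?_ (ENNReal.le_tsum 0)
      gcongr
      exact hDP i 0
    · gcongr with i
      exact tsum_volume_le (hDc i) (interior_diagCube_inter hn (a i) (hl i) hr hr1) (hDP i)
  have hsup : ∀ i, (volume (P i))⁻¹ * J (P i) =
      ⨆ k : ℕ, (volume (P i))⁻¹ * J (D (1 / ((k : ℝ) + 2)) i 0) := fun i => by
    rw [← ENNReal.mul_iSup]
    congr 1
    have := lintegral_eq_iSup_diagCube hg (a i) (hl i)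
    rw [← hPa i] at this
    exact this
  change ∑' i, (volume (P i))⁻¹ * J (P i) ≤ _
  simp_rw [hsup]
  rw [ENNReal.tsum_eq_iSup_sum]
  refine iSup_le fun s => ?_
  rw [ENNReal.finsetSum_iSup_of_monotone]
  · refine iSup_le fun k => (ENNReal.sum_le_tsum s).trans (hstep _ (by positivity) ?_)
    exact (div_lt_one (by positivity)).2 (by linarith [k.cast_nonneg (α := ℝ)])
  · intro i j k hjk
    have hmono : D (1 / ((j : ℝ) + 2)) i 0 ⊆ D (1 / ((k : ℝ) + 2)) i 0 :=
      monotone_diagCube_zero (a i) (hl i) hjk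
    dsimp only [J]
    gcongr

end Cubes

section Dyadic

variable {n : ℕ}

/-- The label of the dyadic cell of generation `m` (relative to the box with corner `a` and side
`l`) containing `x`. -/
def dyadicIdx (a : Fin n → ℝ) (l : ℝ) (m : ℕ) (x : Fin n → ℝ) : Fin n → ℤ :=
  fun i => ⌊2 ^ m * ((x i - a i) / l)⌋

lemma dyadicIdx_eq_of_succ (a : Fin n → ℝ) (l : ℝ) (m : ℕ) (x y : Fin n → ℝ)
    (h : dyadicIdx a l (m + 1) x = dyadicIdx a l (m + 1) y) :
    dyadicIdx a l m x = dyadicIdx a l m y := by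
  have key : ∀ z : ℝ, ⌊2 ^ m * z⌋ = ⌊2 ^ (m + 1) * z⌋ / 2 := fun z => by
    have := Int.floor_div_natCast (2 ^ (m + 1) * z) 2
    rw [Nat.cast_ofNat, Nat.cast_ofNat] at this
    rw [← this]
    congr 1
    ring
  funext i
  have := congrFun h i
  simp only [dyadicIdx] at this ⊢
  rw [key, key, this]

/-- The closed dyadic cube of generation `m` with label `k`. -/
def dyadicCube (a : Fin n → ℝ) (l : ℝ) (m : ℕ) (k : Fin n → ℤ) : Set (Fin n → ℝ) :=
  univ.pi fun i => Icc (a i + l / 2 ^ m * k i) (a i + l / 2 ^ m * k i + l / 2 ^ m)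

variable {a : Fin n → ℝ} {l : ℝ}

lemma isCube_dyadicCube (hl : 0 < l) (m : ℕ) (k : Fin n → ℤ) : IsCube (dyadicCube a l m k) :=
  ⟨_, _, by positivity, rfl⟩

lemma dyadicIdx_eq_iff (hl : 0 < l) {m : ℕ} {k : Fin n → ℤ} {x : Fin n → ℝ} :
    dyadicIdx a l m x = k ↔
      ∀ i, x i ∈ Ico (a i + l / 2 ^ m * k i) (a i + l / 2 ^ m * k i + l / 2 ^ m) := by
  have h2 : (0 : ℝ) < 2 ^ m := by positivity
  rw [funext_iff]
  refine forall_congr' fun i => ?_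
  have e : 2 ^ m * ((x i - a i) / l) = (x i - a i) / (l / 2 ^ m) := by field_simp
  have h3 : 0 < l / 2 ^ m := by positivity
  rw [dyadicIdx, Int.floor_eq_iff, e, le_div_iff₀ h3, div_lt_iff₀ h3, mem_Ico]
  constructor <;> rintro ⟨h, h'⟩ <;> constructor <;> linarith

lemma mem_dyadicCube (hl : 0 < l) {m : ℕ} {k : Fin n → ℤ} {x : Fin n → ℝ}
    (hx : dyadicIdx a l m x = k) : x ∈ dyadicCube a l m k := fun i _ =>
  Ico_subset_Icc_self ((dyadicIdx_eq_iff hl).1 hx i)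

lemma interior_dyadicCube_subset (hl : 0 < l) (m : ℕ) (k : Fin n → ℤ) :
    interior (dyadicCube a l m k) ⊆ {x | dyadicIdx a l m x = k} := by
  intro x hx
  refine (dyadicIdx_eq_iff hl).2 fun i => ?_
  simp only [dyadicCube, interior_pi_set finite_univ, interior_Icc] at hx
  exact Ioo_subset_Ico_self (hx i trivial)

lemma dyadicCube_eq_closure (hl : 0 < l) (m : ℕ) (k : Fin n → ℤ) :
    dyadicCube a l m k = closure {x | dyadicIdx a l m x = k} := by
  have : {x | dyadicIdx a l m x = k} =
      univ.pi fun i => Ico (a i + l / 2 ^ m * k i) (a i + l / 2 ^ m * k i + l / 2 ^ m) := by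
    ext x
    rw [mem_univ_pi]
    exact dyadicIdx_eq_iff hl
  rw [this, closure_pi_set]
  have hne : ∀ i, a i + l / 2 ^ m * k i ≠ a i + l / 2 ^ m * k i + l / 2 ^ m := fun i => by
    have : 0 < l / 2 ^ m := by positivity
    linarith
  simp_rw [closure_Ico (hne _)]
  rfl

lemma dyadicCube_mono (hl : 0 < l) {m m' : ℕ} {k k' : Fin n → ℤ}
    (h : ∀ x, dyadicIdx a l m x = k → dyadicIdx a l m' x = k') :
    dyadicCube a l m k ⊆ dyadicCube a l m' k' := by
  rw [dyadicCube_eq_closure hl, dyadicCube_eq_closure hl]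
  exact closure_mono h

lemma volume_dyadicCube (m : ℕ) (k : Fin n → ℤ) :
    volume (dyadicCube a l m k) = ENNReal.ofReal (l / 2 ^ m) ^ n :=
  volume_box _ _

lemma volume_dyadicCube_succ (m : ℕ) (k k' : Fin n → ℤ) :
    volume (dyadicCube a l m k) = 2 ^ n * volume (dyadicCube a l (m + 1) k') := by
  rw [volume_dyadicCube, volume_dyadicCube, ← mul_pow]
  congr 1
  rw [← ENNReal.ofReal_ofNat 2, ← ENNReal.ofReal_mul zero_le_two]
  congr 1
  field_simp
  ring

lemma dyadicCube_zero_zero : dyadicCube a l 0 0 = univ.pi fun i => Icc (a i) (a i + l) := by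
  simp [dyadicCube]

lemma dyadicCube_eq_closedBall (hl : 0 < l) (m : ℕ) (k : Fin n → ℤ) :
    dyadicCube a l m k =
      Metric.closedBall (fun i => a i + l / 2 ^ m * k i + l / 2 ^ m / 2) (l / 2 ^ m / 2) := by
  rw [closedBall_pi _ (by positivity)]
  simp_rw [Real.closedBall_eq_Icc]
  unfold dyadicCube
  congr! 3 <;> ring

lemma ae_exists_dense_dyadicCube (hl : 0 < l) (E : Set (Fin n → ℝ)) :
    ∀ᵐ x ∂volume.restrict E, ∃ m, volume (dyadicCube a l m (dyadicIdx a l m x)) <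
      2 * volume (E ∩ dyadicCube a l m (dyadicIdx a l m x)) := by
  filter_upwards [IsUnifLocDoublingMeasure.ae_tendsto_measure_inter_div volume E 1] with x hx
  have hδ : Filter.Tendsto (fun m : ℕ => l / 2 ^ m / 2) Filter.atTop (nhdsWithin 0 (Ioi 0)) := by
    refine tendsto_nhdsWithin_iff.2 ⟨?_, Filter.Eventually.of_forall fun m => ?_⟩
    · have h := (tendsto_pow_atTop_nhds_zero_of_lt_one (by norm_num : (0 : ℝ) ≤ 1 / 2)
        (by norm_num)).const_mul (l / 2)
      rw [mul_zero] at h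
      refine h.congr fun m => ?_
      rw [one_div, inv_pow]
      ring
    · exact mem_Ioi.2 (by positivity)
  have h := hx (fun m i => a i + l / 2 ^ m * dyadicIdx a l m x i + l / 2 ^ m / 2) _ hδ
    (Filter.Eventually.of_forall fun m => by
      rw [one_mul, ← dyadicCube_eq_closedBall hl]
      exact mem_dyadicCube hl rfl)
  obtain ⟨m, hm⟩ := (h.eventually (lt_mem_nhds (by norm_num : (2 : ℝ≥0∞)⁻¹ < 1))).exists
  refine ⟨m, ?_⟩
  simp_rw [← dyadicCube_eq_closedBall hl] at hm
  have hc := isCube_dyadicCube (a := a) hl m (dyadicIdx a l m x)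
  rw [ENNReal.lt_div_iff_mul_lt (Or.inl hc.volume_ne_zero) (Or.inl hc.volume_ne_top)] at hm
  calc volume (dyadicCube a l m (dyadicIdx a l m x))
      = 2 * (2⁻¹ * volume (dyadicCube a l m (dyadicIdx a l m x))) := by
        rw [← mul_assoc, ENNReal.mul_inv_cancel two_ne_zero ENNReal.ofNat_ne_top, one_mul]
    _ < _ := by
        rwa [ENNReal.mul_lt_mul_iff_right two_ne_zero ENNReal.ofNat_ne_top]

/-- Calderón–Zygmund covering: a subset of relative measure at most `1/2` in a cube is covered, up
to a null set, by non-overlapping subcubes in each of which its relative measure lies between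
`2^{-n-1}` and `1/2`. -/
lemma exists_calderonZygmund_cover {Q₀ E : Set (Fin n → ℝ)} (hQ₀ : IsCube Q₀) (hE : E ⊆ Q₀)
    (hhalf : 2 * volume E ≤ volume Q₀) :
    ∃ I : Set (ℕ × (Fin n → ℤ)), ∃ P : I → Set (Fin n → ℝ), (∀ i, IsCube (P i)) ∧
      (Pairwise fun i j => interior (P i) ∩ interior (P j) = ∅) ∧ (∀ i, P i ⊆ Q₀) ∧
      (∀ i, 2 * volume (E ∩ P i) ≤ volume (P i)) ∧
      (∀ i, volume (P i) ≤ 2 ^ (n + 1) * volume (E ∩ P i)) ∧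
      ∀ᵐ x ∂volume.restrict E, x ∈ ⋃ i, P i := by
  obtain ⟨a, l, hl, hQ⟩ := id hQ₀
  rw [← dyadicCube_zero_zero] at hQ
  set D : ℕ → (Fin n → ℤ) → Prop := fun m k =>
    volume (dyadicCube a l m k) < 2 * volume (E ∩ dyadicCube a l m k)
  have h0 : ∀ x, ¬ D 0 (dyadicIdx a l 0 x) := by
    intro x hD
    have h1 : volume (dyadicCube a l 0 (dyadicIdx a l 0 x)) = volume Q₀ := by
      rw [hQ, volume_dyadicCube, volume_dyadicCube]
    have h2 : volume (E ∩ dyadicCube a l 0 (dyadicIdx a l 0 x)) ≤ volume E :=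
      measure_mono inter_subset_left
    refine absurd hD (not_lt.2 ?_)
    rw [h1]
    exact le_trans (by gcongr) hhalf
  obtain ⟨I, hI1, hI2, hI3⟩ := exists_maximal_parent_cells (dyadicIdx a l)
    (dyadicIdx_eq_of_succ a l) D h0
  refine ⟨I, fun i => dyadicCube a l i.1.1 i.1.2, fun i => isCube_dyadicCube hl _ _,
    fun i j hij => ?_, fun i => ?_, fun i => ?_, fun i => ?_, ?_⟩
  · refine eq_empty_of_forall_notMem fun z hz => hij (Subtype.ext ?_)
    exact hI2 _ i.2 _ j.2 z (interior_dyadicCube_subset hl _ _ hz.1)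
      (interior_dyadicCube_subset hl _ _ hz.2)
  · obtain ⟨-, y, hy, hD⟩ := hI1 _ i.2
    have hle : ∀ m x y, dyadicIdx a l m x = dyadicIdx a l m y →
        dyadicIdx a l 0 x = dyadicIdx a l 0 y := by
      intro m x y h
      induction m with
      | zero => exact h
      | succ m ih => exact ih (dyadicIdx_eq_of_succ a l m x y h)
    have hpos : volume (E ∩ dyadicCube a l (i.1.1 + 1) (dyadicIdx a l (i.1.1 + 1) y)) ≠ 0 := by
      intro h
      simp [D, h] at hD
    have hne : volume (interior (dyadicCube a l (i.1.1 + 1) (dyadicIdx a l (i.1.1 + 1) y)) ∩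
        interior Q₀) ≠ 0 := by
      have hae := (isCube_dyadicCube (a := a) hl (i.1.1 + 1)
        (dyadicIdx a l (i.1.1 + 1) y)).interior_ae_eq.inter hQ₀.interior_ae_eq
      rw [measure_congr hae]
      refine fun h => hpos (measure_mono_null ?_ h)
      exact fun x hx => ⟨hx.2, hE hx.1⟩
    obtain ⟨z, hz1, hz2⟩ := nonempty_of_measure_ne_zero hne
    rw [hQ] at hz2 ⊢
    have hz1' := dyadicIdx_eq_of_succ a l _ _ _ (interior_dyadicCube_subset hl _ _ hz1)
    have hz2' := interior_dyadicCube_subset hl _ _ hz2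
    refine dyadicCube_mono hl fun x hx => ?_
    rw [← hz2']
    exact hle i.1.1 x z (by rw [hx, hz1', hy])
  · exact not_lt.1 (hI1 _ i.2).1
  · obtain ⟨-, y, hy, hD⟩ := hI1 _ i.2
    rw [volume_dyadicCube_succ _ _ (dyadicIdx a l (i.1.1 + 1) y), pow_succ, mul_assoc]
    gcongr
    refine hD.le.trans ?_
    gcongr
    refine dyadicCube_mono hl fun x hx => ?_
    rw [dyadicIdx_eq_of_succ a l _ _ _ hx, hy]
  · filter_upwards [ae_exists_dense_dyadicCube (a := a) hl E] with x ⟨m, hm⟩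
    obtain ⟨q, hq, hx⟩ := hI3 x m hm
    exact mem_iUnion.2 ⟨⟨q, hq⟩, mem_dyadicCube hl hx⟩

end Dyadic

section GarsiaRodemich

variable {n : ℕ} {g : (Fin n → ℝ) → ℝ}

lemma lintegral_sub_le_of_half {P : Set (Fin n → ℝ)} (hP : IsCube P) (hg : Measurable g) (s : ℝ)
    (hhalf : 2 * volume ({x | s < |g x|} ∩ P) ≤ volume P) :
    ∫⁻ x in P, ENNReal.ofReal (|g x| - s) ≤
      (volume P)⁻¹ * ∫⁻ x in P, ∫⁻ y in P, ENNReal.ofReal |g x - g y| := by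
  set A : Set (Fin n → ℝ) := {x | s < |g x|}
  have hA : MeasurableSet A := measurableSet_lt measurable_const (continuous_abs.measurable.comp hg)
  set h : (Fin n → ℝ) → ℝ≥0∞ := fun x => ENNReal.ofReal (|g x| - s)
  have hh : Measurable h := ((continuous_abs.measurable.comp hg).sub_const s).ennreal_ofReal
  set v := volume (Aᶜ ∩ P)
  set H := ∫⁻ x in P, h x
  have hP0 := hP.volume_ne_zero
  have hPt := hP.volume_ne_top
  have hHA : H = ∫⁻ x in A, h x ∂volume.restrict P := by
    refine (setLIntegral_eq_of_support_subset ?_).symm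
    intro x hx
    by_contra hxA
    exact hx (ENNReal.ofReal_of_nonpos (sub_nonpos.2 (not_lt.1 hxA)))
  have hvA : volume.restrict P Aᶜ = v := Measure.restrict_apply hA.compl
  have hv : volume P ≤ 2 * v := by
    have h1 : volume P = volume (A ∩ P) + v := by
      rw [inter_comm A P, show v = volume (P \ A) by rw [sdiff_eq, inter_comm],
        measure_inter_add_sdiff P hA]
    have h2 : volume (A ∩ P) ≠ ∞ := measure_ne_top_of_subset inter_subset_right hPt
    have h3 : volume (A ∩ P) + volume (A ∩ P) ≤ volume (A ∩ P) + v := by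
      rwa [← two_mul, ← h1]
    rw [h1, two_mul]
    gcongr
    exact (ENNReal.add_le_add_iff_left h2).1 h3
  have hFA : ∀ x y, y ∈ Aᶜ → h x ≤ ENNReal.ofReal |g x - g y| := by
    intro x y hy
    refine ENNReal.ofReal_le_ofReal ?_
    have : |g y| ≤ s := not_lt.1 (show ¬ s < |g y| from hy)
    have := abs_sub_abs_le_abs_sub (g x) (g y)
    linarith
  have hdouble : 2 * (H * v) ≤ ∫⁻ x in P, ∫⁻ y in P, ENNReal.ofReal |g x - g y| := by
    rw [two_mul, ← lintegral_add_compl _ hA]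
    refine add_le_add ?_ ?_
    · rw [hHA, ← lintegral_mul_const _ hh]
      refine lintegral_mono fun x => ?_
      refine le_trans ?_ (setLIntegral_le_lintegral Aᶜ _)
      rw [← hvA, ← setLIntegral_const]
      exact setLIntegral_mono' hA.compl fun y hy => hFA x y hy
    · rw [← hvA, ← setLIntegral_const]
      refine setLIntegral_mono' hA.compl fun x hx => ?_
      refine lintegral_mono fun y => ?_
      rw [abs_sub_comm]
      exact hFA y x hx
  rw [mul_comm, ← div_eq_mul_inv, ENNReal.le_div_iff_mul_le (Or.inl hP0) (Or.inl hPt)]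
  calc H * volume P ≤ H * (2 * v) := by gcongr
    _ = 2 * (H * v) := by ring
    _ ≤ _ := hdouble

lemma setLIntegral_sub_le_of_forall_packing {q : ℝ} (hq : 0 ≤ q) {Q₀ : Set (Fin n → ℝ)}
    (hQ₀ : IsCube Q₀) (hg : Measurable g) {C : ℝ≥0∞}
    (hC : ∀ Q : ℕ → Set (Fin n → ℝ), IsPackingIn Q₀ Q →
      (∑' i, (volume (Q i))⁻¹ * ∫⁻ x in Q i, ∫⁻ y in Q i, ENNReal.ofReal |g x - g y|) ≤
        C * (∑' i, volume (Q i)) ^ q)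
    (s : ℝ) (hhalf : 2 * volume ({x | s < |g x|} ∩ Q₀) ≤ volume Q₀) :
    ∫⁻ x in Q₀, ENNReal.ofReal (|g x| - s) ≤
      C * (2 ^ (n + 1) * volume ({x | s < |g x|} ∩ Q₀)) ^ q := by
  set A : Set (Fin n → ℝ) := {x | s < |g x|}
  have hA : MeasurableSet A := measurableSet_lt measurable_const (continuous_abs.measurable.comp hg)
  have hE : MeasurableSet (A ∩ Q₀) := hA.inter hQ₀.measurableSet
  have hAE : ∫⁻ x in Q₀, ENNReal.ofReal (|g x| - s) =
      ∫⁻ x in A ∩ Q₀, ENNReal.ofReal (|g x| - s) := by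
    rw [← Measure.restrict_restrict hA]
    refine (setLIntegral_eq_of_support_subset ?_).symm
    intro x hx
    by_contra hxA
    exact hx (ENNReal.ofReal_of_nonpos (sub_nonpos.2 (not_lt.1 hxA)))
  rw [hAE]
  by_cases hE0 : volume (A ∩ Q₀) = 0
  · rw [setLIntegral_measure_zero _ _ hE0]
    exact zero_le
  have hn : 0 < n := by
    by_contra! h
    obtain rfl : n = 0 := by omega
    obtain ⟨x, hx⟩ := nonempty_of_measure_ne_zero hE0
    have h1 : A ∩ Q₀ = Q₀ :=
      inter_eq_self_of_subset_right fun y _ => Subsingleton.elim x y ▸ hx.1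
    rw [h1] at hhalf
    refine absurd hhalf (not_le.2 ?_)
    rw [two_mul]
    exact ENNReal.lt_add_right hQ₀.volume_ne_top hQ₀.volume_ne_zero
  obtain ⟨I, P, hP, hd, hsub, hle, hge, hcov⟩ :=
    exists_calderonZygmund_cover hQ₀ inter_subset_right hhalf
  have hEP : ∀ i, A ∩ Q₀ ∩ P i = A ∩ P i := fun i => by
    rw [inter_assoc, inter_eq_self_of_subset_right (hsub i)]
  calc ∫⁻ x in A ∩ Q₀, ENNReal.ofReal (|g x| - s)
      ≤ ∫⁻ x in ⋃ i, P i, ENNReal.ofReal (|g x| - s) :=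
        lintegral_mono_set' ((ae_restrict_iff' hE).1 hcov)
    _ ≤ ∑' i, ∫⁻ x in P i, ENNReal.ofReal (|g x| - s) := lintegral_iUnion_le _ _
    _ ≤ ∑' i, (volume (P i))⁻¹ * ∫⁻ x in P i, ∫⁻ y in P i, ENNReal.ofReal |g x - g y| :=
        ENNReal.tsum_le_tsum fun i =>
          lintegral_sub_le_of_half (hP i) hg s (by simpa only [hEP] using hle i)
    _ ≤ C * (∑' i, volume (P i)) ^ q := tsum_le_of_forall_packing hq hn hg hC hP hd hsub
    _ ≤ C * (2 ^ (n + 1) * volume (A ∩ Q₀)) ^ q := by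
        gcongr
        refine (ENNReal.tsum_le_tsum hge).trans ?_
        rw [ENNReal.tsum_mul_left]
        gcongr
        exact tsum_volume_inter_le hP hd _

lemma GaRo_congr_ae {f : (Fin n → ℝ) → ℝ} {Q₀ : Set (Fin n → ℝ)}
    (h : f =ᵐ[volume.restrict Q₀] g) (p : ℝ) : GaRo p f Q₀ = GaRo p g Q₀ := by
  have key : ∀ Q ⊆ Q₀, ∫⁻ x in Q, ∫⁻ y in Q, ENNReal.ofReal |f x - f y| =
      ∫⁻ x in Q, ∫⁻ y in Q, ENNReal.ofReal |g x - g y| := by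
    intro Q hQ
    have hQ' := ae_restrict_of_ae_restrict_of_subset hQ h
    refine lintegral_congr_ae ?_
    filter_upwards [hQ'] with x hx
    refine lintegral_congr_ae ?_
    filter_upwards [hQ'] with y hy
    rw [hx, hy]
  unfold GaRo
  congr 1
  ext C
  refine forall_congr' fun Q => forall_congr' fun hQ => ?_
  rw [tsum_congr fun i => by rw [key (Q i) (hQ.1 i).2]]

end GarsiaRodemich

/-- `sup_{t>0} t^{1/p} (f**(t) - f*(t))
    ≤ 2^{n/p'+1} GaRo_p(f,Q₀) + (4/|Q₀|)^{1/p'} ‖f‖_{L¹(Q₀)}`. -/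
theorem osc_le_gaRo {n : ℕ} (p p' : ℝ) (hp : 1 < p) (hpp' : 1 / p + 1 / p' = 1)
    (Q₀ : Set (Fin n → ℝ)) (hQ₀ : IsCube Q₀)
    (f : (Fin n → ℝ) → ℝ) (hf : IntegrableOn f Q₀) :
    (⨆ (t : ℝ) (_ : 0 < t),
        ENNReal.ofReal t ^ (1 / p) *
          (dstar (volume.restrict Q₀) f t - rearr (volume.restrict Q₀) f t)) ≤
      2 ^ ((n : ℝ) / p' + 1) * GaRo p f Q₀ +
        (4 / volume Q₀) ^ (1 / p') * ∫⁻ x in Q₀, ENNReal.ofReal |f x| := by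
  have hp1 : 1 / p < 1 := (div_lt_one (by linarith)).2 hp
  have hpos : 0 < 1 / p := by positivity
  obtain ⟨q, hq⟩ : ∃ q, q = 1 / p' := ⟨_, rfl⟩
  have hq0 : 0 < q := by linarith
  have hq1 : q < 1 := by linarith
  have hqp : 1 - 1 / p = q := by linarith
  have hnq : (n : ℝ) / p' + 1 = n * q + 1 := by rw [hq]; ring
  rw [hnq, ← hq]
  refine iSup₂_le fun t ht => ?_
  set T := ENNReal.ofReal t
  have hT0 : T ≠ 0 := by simpa [T] using ht
  have hTt : T ≠ ∞ := ENNReal.ofReal_ne_top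
  have hTp : T ^ (1 / p) * T⁻¹ = (T ^ q)⁻¹ := by
    rw [← ENNReal.rpow_neg, ← ENNReal.rpow_neg_one,
      ← ENNReal.rpow_add _ _ hT0 hTt]
    congr 1
    linarith
  have hV0 := hQ₀.volume_ne_zero
  have hVt := hQ₀.volume_ne_top
  rcases lt_or_ge (volume Q₀) (4 * T) with hbig | hsmall
  · refine le_trans ?_ le_add_self
    calc T ^ (1 / p) * (dstar (volume.restrict Q₀) f t - rearr (volume.restrict Q₀) f t)
        ≤ T ^ (1 / p) * ((∫⁻ x in Q₀, ENNReal.ofReal |f x|) / T) := by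
          gcongr
          refine tsub_le_self.trans ?_
          unfold dstar
          gcongr
          exact lintegral_rearr_le hf t
      _ = (T ^ q)⁻¹ * ∫⁻ x in Q₀, ENNReal.ofReal |f x| := by
          rw [← hTp, div_eq_mul_inv _ T]
          ring
      _ ≤ _ := by
          gcongr
          rw [← ENNReal.inv_rpow]
          gcongr
          rw [ENNReal.le_div_iff_mul_le (Or.inl hV0) (Or.inl hVt), mul_comm,
            ← div_eq_mul_inv]
          exact ENNReal.div_le_of_le_mul hbig.le
  · refine le_trans ?_ le_self_add
    obtain ⟨g, hg, hfg⟩ := hf.aemeasurable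
    rw [GaRo_congr_ae hfg, dstar_congr_ae hfg, rearr_congr_ae hfg]
    have hgi : Integrable g (volume.restrict Q₀) := hf.congr hfg
    have h2 : (2 : ℝ≥0∞) ^ ((n : ℝ) * q + 1) ≠ 0 :=
      (ENNReal.rpow_pos (by norm_num) ENNReal.ofNat_ne_top).ne'
    have h2t : (2 : ℝ≥0∞) ^ ((n : ℝ) * q + 1) ≠ ∞ :=
      ENNReal.rpow_ne_top_of_nonneg (by positivity) ENNReal.ofNat_ne_top
    rw [mul_comm (2 ^ _) (GaRo p g Q₀), ← ENNReal.div_le_iff h2 h2t]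
    refine le_sInf fun C hC => ?_
    rw [ENNReal.div_le_iff h2 h2t]
    set s := (rearr (volume.restrict Q₀) g t).toReal
    have hA : volume ({x | s < |g x|} ∩ Q₀) ≤ T := by
      rw [← Measure.restrict_apply' hQ₀.measurableSet]
      exact distFun_toReal_rearr_le hgi ht
    have hhalf : 2 * volume ({x | s < |g x|} ∩ Q₀) ≤ volume Q₀ := by
      refine le_trans ?_ hsmall
      gcongr
      norm_num
    have hmain := setLIntegral_sub_le_of_forall_packing hq0.le hQ₀ hg
      (fun Q hQ => by simpa only [hqp] using hC Q hQ) s hhalf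
    have hTq0 : T ^ q ≠ 0 := (ENNReal.rpow_pos (pos_iff_ne_zero.2 hT0) hTt).ne'
    have hTqt : T ^ q ≠ ∞ := ENNReal.rpow_ne_top_of_nonneg hq0.le hTt
    calc T ^ (1 / p) * (dstar (volume.restrict Q₀) g t - rearr (volume.restrict Q₀) g t)
        ≤ T ^ (1 / p) * ((C * (2 ^ (n + 1) * T) ^ q) / T) := by
          gcongr
          refine (dstar_sub_rearr_le hgi ht).trans ?_
          gcongr
          refine hmain.trans ?_
          gcongr
      _ = C * (2 ^ (n + 1)) ^ q * (T ^ q * (T ^ q)⁻¹) := by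
          rw [← hTp, ENNReal.mul_rpow_of_nonneg _ _ hq0.le, div_eq_mul_inv _ T]
          ring
      _ = C * (2 ^ (n + 1)) ^ q := by rw [ENNReal.mul_inv_cancel hTq0 hTqt, mul_one]
      _ ≤ C * 2 ^ ((n : ℝ) * q + 1) := by
          gcongr
          rw [← ENNReal.rpow_natCast, ← ENNReal.rpow_mul]
          refine ENNReal.rpow_le_rpow_of_exponent_le (by norm_num) ?_
          push_cast
          nlinarith
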